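/- Let n ≥ 1 and let w be a permutation of {1,…,2n+1}. In ℤ[Y₁,…,Y_n] set P_w := (−2)^n · ∏_{i=1}^{n} (ρ(w(i)) + ρ(w(n+1)))·(ρ(w(n+1)) + ρ(w(2n+2−i))) · ∏_{1≤i<j≤n} (ρ(w(i)) + ρ(w(j)))·(ρ(w(i)) + ρ(w(2n+2−j))). Then: if w is signed, P_w = (−1)^{inv(|w|)} · 2^n · ∏_{i=1}^{n} Y_i² · ∏_{1≤i<j≤n} (Y_i + Y_j)(Y_i − Y_j); and if w is not signed, P_w = 0. -/

import Mathlib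

/-!
Statement 0: restriction property of the polynomial representing the equivariant class
of the closed `SO(2n+1)`-orbit.  We work 0-indexed: positions `0,…,2n` correspond to
`1,…,2n+1`; the 1-based `n+1` is position `n`, and 1-based `2n+2−i` is position `2n−i`.
-/

/-- The variable `Y_k` of `ℤ[Y₁,…,Yₙ]` (0-indexed), or `0` if `k` is out of range. -/
noncomputable def Yv (n : ℕ) (k : ℕ) : MvPolynomial (Fin n) ℤ :=
  if h : k < n then MvPolynomial.X ⟨k, h⟩ else 0

/-- `ρ` in the odd case (0-indexed): `ρ(k) = Y_k` for `k < n`, `ρ(n) = 0`,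
`ρ(k) = −Y_{2n−k}` for `k > n`. -/
noncomputable def rhoOdd (n : ℕ) (k : ℕ) : MvPolynomial (Fin n) ℤ :=
  if k < n then Yv n k else if k = n then 0 else - Yv n (2 * n - k)

/-- `w` is a signed permutation: `w(2n+2−i) = 2n+2−w(i)` for all `i`
(0-indexed: `w(2n−k) = 2n−w(k)`). -/
def SignedOdd (n : ℕ) (w : Equiv.Perm (Fin (2 * n + 1))) : Prop :=
  ∀ k : Fin (2 * n + 1), ((w ⟨2 * n - (k : ℕ), by omega⟩ : Fin (2 * n + 1)) : ℕ)
    = 2 * n - ((w k : Fin (2 * n + 1)) : ℕ)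

/-- The "absolute value" `|w|(i)`: `w(i)` if `w(i) ≤ n` (1-based), else `2n+2−w(i)`. -/
def absOdd (n : ℕ) (w : Equiv.Perm (Fin (2 * n + 1))) (i : Fin n) : ℕ :=
  if ((w ⟨(i : ℕ), by omega⟩ : Fin (2 * n + 1)) : ℕ) < n then
    ((w ⟨(i : ℕ), by omega⟩ : Fin (2 * n + 1)) : ℕ)
  else 2 * n - ((w ⟨(i : ℕ), by omega⟩ : Fin (2 * n + 1)) : ℕ)

/-- The number of inversions of `|w|`: pairs `i < j` with `|w|(i) > |w|(j)`. -/
def invOdd (n : ℕ) (w : Equiv.Perm (Fin (2 * n + 1))) : ℕ :=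
  (Finset.univ.filter fun p : Fin n × Fin n =>
    p.1 < p.2 ∧ absOdd n w p.2 < absOdd n w p.1).card

/-- The polynomial
`P_w = (−2)^n ∏_{i=1}^n (ρ(w(i))+ρ(w(n+1)))(ρ(w(n+1))+ρ(w(2n+2−i)))
  ∏_{1≤i<j≤n} (ρ(w(i))+ρ(w(j)))(ρ(w(i))+ρ(w(2n+2−j)))`. -/
noncomputable def POdd (n : ℕ) (w : Equiv.Perm (Fin (2 * n + 1))) :
    MvPolynomial (Fin n) ℤ :=
  (-2) ^ n *
    (∏ i : Fin n,
      (rhoOdd n ((w ⟨(i : ℕ), by omega⟩ : Fin (2 * n + 1)) : ℕ) +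
          rhoOdd n ((w ⟨n, by omega⟩ : Fin (2 * n + 1)) : ℕ)) *
      (rhoOdd n ((w ⟨n, by omega⟩ : Fin (2 * n + 1)) : ℕ) +
          rhoOdd n ((w ⟨2 * n - (i : ℕ), by omega⟩ : Fin (2 * n + 1)) : ℕ))) *
    (∏ p ∈ Finset.univ.filter (fun p : Fin n × Fin n => p.1 < p.2),
      (rhoOdd n ((w ⟨(p.1 : ℕ), by omega⟩ : Fin (2 * n + 1)) : ℕ) +
          rhoOdd n ((w ⟨(p.2 : ℕ), by omega⟩ : Fin (2 * n + 1)) : ℕ)) *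
      (rhoOdd n ((w ⟨(p.1 : ℕ), by omega⟩ : Fin (2 * n + 1)) : ℕ) +
          rhoOdd n ((w ⟨2 * n - (p.2 : ℕ), by omega⟩ : Fin (2 * n + 1)) : ℕ)))

open Finset

theorem Finset.prod_univ_filter_lt {n : ℕ} {M : Type*} [CommMonoid M] (F : Fin n × Fin n → M) :
    ∏ p ∈ univ.filter (fun p : Fin n × Fin n => p.1 < p.2), F p =
      ∏ i, ∏ j ∈ Ioi i, F (i, j) :=
  prod_finset_product _ _ _ (by simp)

theorem Equiv.Perm.sign_eq_neg_one_pow_card_inversions {n : ℕ} (σ : Equiv.Perm (Fin n)) :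
    (σ.sign : ℤ) = (-1) ^ (univ.filter fun p : Fin n × Fin n =>
      p.1 < p.2 ∧ σ p.2 < σ p.1).card := by
  rw [σ.sign_eq_prod_prod_Ioi,
    ← prod_univ_filter_lt (fun p : Fin n × Fin n => if σ p.1 < σ p.2 then (1 : ℤˣ) else -1),
    prod_ite, prod_const_one, one_mul, prod_const, filter_filter]
  push_cast
  congr 2
  ext ⟨i, j⟩
  simp only [mem_filter, mem_univ, true_and, not_lt]
  refine and_congr_right fun hij => ⟨fun h => lt_of_le_of_ne h fun e => ?_, le_of_lt⟩
  exact hij.ne' (σ.injective e)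

theorem rhoOdd_reflect {n a : ℕ} (ha : a ≤ 2 * n) : rhoOdd n (2 * n - a) = -rhoOdd n a := by
  rcases lt_trichotomy a n with h | rfl | h
  · rw [rhoOdd, rhoOdd, if_neg (by omega), if_neg (by omega), if_pos h,
      show 2 * n - (2 * n - a) = a by omega]
  · simp [rhoOdd, show 2 * a - a = a by omega]
  · simp [rhoOdd, show 2 * n - a < n by omega, show ¬ a < n by omega, h.ne']

theorem rhoOdd_add_eq_zero {n a b : ℕ} (h : a + b = 2 * n) : rhoOdd n a + rhoOdd n b = 0 := by
  rw [show b = 2 * n - a by omega, rhoOdd_reflect (by omega), add_neg_cancel]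

/-- A bijection of `{0,…,2n}` commutes with the reflection `k ↦ 2n - k` as soon as no two
positions `i`, `j` with `i ≤ n`, `i < j < 2n - i` take values that are reflections
of each other. -/
theorem reflect_comm_of_add_ne {n : ℕ} {f : ℕ → ℕ} (hle : ∀ k ≤ 2 * n, f k ≤ 2 * n)
    (hinj : ∀ a ≤ 2 * n, ∀ b ≤ 2 * n, f a = f b → a = b)
    (hsurj : ∀ y ≤ 2 * n, ∃ k ≤ 2 * n, f k = y)
    (hleft : ∀ i < n, f i + f n ≠ 2 * n) (hright : ∀ i < n, f n + f (2 * n - i) ≠ 2 * n)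
    (hpair : ∀ i j, i < j → j < n → f i + f j ≠ 2 * n)
    (hpair' : ∀ i j, i < j → j < n → f i + f (2 * n - j) ≠ 2 * n) :
    ∀ k ≤ 2 * n, f (2 * n - k) = 2 * n - f k := by
  have hmid : f n = n := by
    obtain ⟨p, hp, hfp⟩ := hsurj (2 * n - f n) (by omega)
    have hn := hle n (by omega)
    rcases lt_trichotomy p n with h | rfl | h
    · exact absurd (by omega) (hleft p h)
    · omega
    · have := hright (2 * n - p) (by omega)
      rw [show 2 * n - (2 * n - p) = p by omega] at this
      omega
  have hlow : ∀ i < n, f (2 * n - i) = 2 * n - f i := by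
    intro i
    induction i using Nat.strong_induction_on with
    | _ i ih =>
    intro hi
    obtain ⟨p, hp, hfp⟩ := hsurj (2 * n - f i) (by omega)
    have hfi := hle i (by omega)
    rcases lt_trichotomy p n with h | rfl | h
    · rcases lt_trichotomy p i with h' | rfl | h'
      · exact absurd (by omega) (hpair p i h' hi)
      · exact absurd (hinj p hp n (by omega) (by omega)) h.ne
      · exact absurd (by omega) (hpair i p h' h)
    · exact absurd (by omega) (hleft i hi)
    · obtain ⟨j, hj, rfl⟩ : ∃ j < n, p = 2 * n - j := ⟨2 * n - p, by omega, by omega⟩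
      rcases lt_trichotomy j i with h' | rfl | h'
      · have hfj := hle j (by omega)
        have := ih j h' hj
        exact absurd (hinj j (by omega) i (by omega) (by omega)) h'.ne
      · exact hfp
      · exact absurd (by omega) (hpair' i j h' hj)
  intro k hk
  rcases lt_trichotomy k n with h | rfl | h
  · exact hlow k h
  · rw [show 2 * k - k = k by omega]; omega
  · have := hlow (2 * n - k) (by omega)
    have := hle (2 * n - k) (by omega)
    have := hle k hk
    rw [show 2 * n - (2 * n - k) = k by omega] at *
    omega

theorem signedOdd_of_POdd_ne_zero {n : ℕ} {w : Equiv.Perm (Fin (2 * n + 1))}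
    (h : POdd n w ≠ 0) : SignedOdd n w := by
  obtain ⟨h, hpairs⟩ := mul_ne_zero_iff.1 h
  have hmids := prod_ne_zero_iff.1 (mul_ne_zero_iff.1 h).2
  rw [prod_ne_zero_iff] at hpairs
  let f : ℕ → ℕ := fun k => if hk : k < 2 * n + 1 then w ⟨k, hk⟩ else 0
  have hf : ∀ k (hk : k < 2 * n + 1), f k = w ⟨k, hk⟩ := fun k hk => dif_pos hk
  have key : ∀ k ≤ 2 * n, f (2 * n - k) = 2 * n - f k := by
    apply reflect_comm_of_add_ne
    · intro k hk
      rw [hf k (by omega)]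
      omega
    · intro a ha b hb hab
      rw [hf a (by omega), hf b (by omega)] at hab
      simpa using w.injective (Fin.ext hab)
    · intro y hy
      refine ⟨w.symm ⟨y, by omega⟩, by omega, ?_⟩
      rw [hf _ (by omega)]
      simp
    · intro i hi hsum
      rw [hf i (by omega), hf n (by omega)] at hsum
      exact (mul_ne_zero_iff.1 (hmids ⟨i, hi⟩ (mem_univ _))).1 (rhoOdd_add_eq_zero hsum)
    · intro i hi hsum
      rw [hf n (by omega), hf (2 * n - i) (by omega)] at hsum
      exact (mul_ne_zero_iff.1 (hmids ⟨i, hi⟩ (mem_univ _))).2 (rhoOdd_add_eq_zero hsum)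
    · intro i j hij hj hsum
      rw [hf i (by omega), hf j (by omega)] at hsum
      exact (mul_ne_zero_iff.1 (hpairs (⟨i, by omega⟩, ⟨j, hj⟩) (by simpa using hij))).1
        (rhoOdd_add_eq_zero hsum)
    · intro i j hij hj hsum
      rw [hf i (by omega), hf (2 * n - j) (by omega)] at hsum
      exact (mul_ne_zero_iff.1 (hpairs (⟨i, by omega⟩, ⟨j, hj⟩) (by simpa using hij))).2
        (rhoOdd_add_eq_zero hsum)
  intro k
  have := key k (by omega)
  rwa [hf _ (by omega), hf _ k.2] at this

theorem SignedOdd.apply_mid {n : ℕ} {w : Equiv.Perm (Fin (2 * n + 1))} (hw : SignedOdd n w) :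
    (w ⟨n, by omega⟩ : ℕ) = n := by
  have h := hw ⟨n, by omega⟩
  simp only [show 2 * n - n = n by omega] at h
  omega

theorem SignedOdd.apply_ne_mid {n : ℕ} {w : Equiv.Perm (Fin (2 * n + 1))} (hw : SignedOdd n w)
    (i : Fin n) : (w ⟨i, by omega⟩ : ℕ) ≠ n := by
  intro h
  have := w.injective (Fin.ext (h.trans hw.apply_mid.symm))
  simp only [Fin.mk.injEq] at this
  omega

theorem SignedOdd.absOdd_lt {n : ℕ} {w : Equiv.Perm (Fin (2 * n + 1))} (hw : SignedOdd n w)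
    (i : Fin n) : absOdd n w i < n := by
  have := hw.apply_ne_mid i
  unfold absOdd
  split_ifs <;> omega

theorem SignedOdd.absOdd_injective {n : ℕ} {w : Equiv.Perm (Fin (2 * n + 1))}
    (hw : SignedOdd n w) : Function.Injective (absOdd n w) := by
  intro i j hij
  have hj := hw ⟨j, by omega⟩
  have hcases : (w ⟨i, by omega⟩ : ℕ) = w ⟨j, by omega⟩ ∨
      (w ⟨i, by omega⟩ : ℕ) = w ⟨2 * n - j, by omega⟩ := by
    unfold absOdd at hij
    dsimp only at hj
    split_ifs at hij <;> omega
  rcases hcases with h | h <;>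
  · have := w.injective (Fin.ext h)
    simp only [Fin.mk.injEq] at this
    omega

/-- The permutation `|w|` of `Fin n` attached to a signed permutation `w`. -/
noncomputable def SignedOdd.absPerm {n : ℕ} {w : Equiv.Perm (Fin (2 * n + 1))}
    (hw : SignedOdd n w) : Equiv.Perm (Fin n) :=
  Equiv.ofBijective (fun i => ⟨absOdd n w i, hw.absOdd_lt i⟩) <|
    Finite.injective_iff_bijective.1 fun _ _ h => hw.absOdd_injective (Fin.mk.inj_iff.1 h)

theorem SignedOdd.coe_absPerm {n : ℕ} {w : Equiv.Perm (Fin (2 * n + 1))}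
    (hw : SignedOdd n w) (i : Fin n) : (hw.absPerm i : ℕ) = absOdd n w i :=
  rfl

theorem SignedOdd.sign_absPerm {n : ℕ} {w : Equiv.Perm (Fin (2 * n + 1))}
    (hw : SignedOdd n w) : (hw.absPerm.sign : ℤ) = (-1) ^ invOdd n w := by
  simp only [Equiv.Perm.sign_eq_neg_one_pow_card_inversions, invOdd, Fin.lt_def, hw.coe_absPerm]

theorem SignedOdd.rhoOdd_sq {n : ℕ} {w : Equiv.Perm (Fin (2 * n + 1))}
    (hw : SignedOdd n w) (i : Fin n) :
    rhoOdd n (w ⟨i, by omega⟩ : ℕ) ^ 2 = MvPolynomial.X (hw.absPerm i) ^ 2 := by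
  have hX : (MvPolynomial.X (hw.absPerm i) : MvPolynomial (Fin n) ℤ) = Yv n (absOdd n w i) := by
    rw [Yv, dif_pos (hw.absOdd_lt i)]
    rfl
  have := hw.apply_ne_mid i
  rw [hX, rhoOdd, absOdd]
  split_ifs <;> simp

theorem SignedOdd.POdd_eq {n : ℕ} {w : Equiv.Perm (Fin (2 * n + 1))} (hw : SignedOdd n w) :
    POdd n w = (-1) ^ invOdd n w * 2 ^ n *
      (∏ i : Fin n, (MvPolynomial.X i : MvPolynomial (Fin n) ℤ) ^ 2) *
      ∏ p ∈ Finset.univ.filter (fun p : Fin n × Fin n => p.1 < p.2),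
        (MvPolynomial.X p.1 + MvPolynomial.X p.2) *
          (MvPolynomial.X p.1 - MvPolynomial.X p.2) := by
  have hneg : ∀ i : Fin n, rhoOdd n (w ⟨2 * n - i, by omega⟩ : ℕ) =
      -rhoOdd n (w ⟨i, by omega⟩ : ℕ) := fun i => by
    rw [← rhoOdd_reflect (by omega), ← hw ⟨i, by omega⟩]
  have hmid : rhoOdd n (w ⟨n, by omega⟩ : ℕ) = 0 := by simp [hw.apply_mid, rhoOdd]
  have hsingle : ∀ i : Fin n,
      (rhoOdd n (w ⟨i, by omega⟩ : ℕ) + rhoOdd n (w ⟨n, by omega⟩ : ℕ)) *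
        (rhoOdd n (w ⟨n, by omega⟩ : ℕ) + rhoOdd n (w ⟨2 * n - i, by omega⟩ : ℕ)) =
      -1 * MvPolynomial.X (hw.absPerm i) ^ 2 := fun i => by
    rw [hmid, hneg, ← hw.rhoOdd_sq]
    ring
  have hpair : ∀ i j : Fin n,
      (rhoOdd n (w ⟨i, by omega⟩ : ℕ) + rhoOdd n (w ⟨j, by omega⟩ : ℕ)) *
        (rhoOdd n (w ⟨i, by omega⟩ : ℕ) + rhoOdd n (w ⟨2 * n - j, by omega⟩ : ℕ)) =
      (MvPolynomial.X (hw.absPerm i) + MvPolynomial.X (hw.absPerm j)) *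
        (MvPolynomial.X (hw.absPerm i) - MvPolynomial.X (hw.absPerm j)) := fun i j => by
    rw [hneg, ← sub_eq_add_neg, ← sq_sub_sq, ← sq_sub_sq, hw.rhoOdd_sq, hw.rhoOdd_sq]
  have hvand := hw.absPerm.prod_Ioi_comp_eq_sign_mul_prod
    (f := fun i j => ((MvPolynomial.X i + MvPolynomial.X j) *
      (MvPolynomial.X i - MvPolynomial.X j) : MvPolynomial (Fin n) ℤ)) (fun i j => by ring)
  rw [POdd, prod_univ_filter_lt, prod_univ_filter_lt]
  simp only [hsingle, hpair]
  rw [hvand, prod_mul_distrib, hw.sign_absPerm,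
    Equiv.prod_comp hw.absPerm fun i => (MvPolynomial.X i : MvPolynomial (Fin n) ℤ) ^ 2,
    prod_const, card_univ, Fintype.card_fin, ← mul_assoc ((-2) ^ n), ← mul_pow]
  push_cast
  norm_num
  ring

theorem stmt0 (n : ℕ) (hn : 1 ≤ n) (w : Equiv.Perm (Fin (2 * n + 1))) :
    (SignedOdd n w →
      POdd n w = (-1) ^ invOdd n w * 2 ^ n *
        (∏ i : Fin n, (MvPolynomial.X i : MvPolynomial (Fin n) ℤ) ^ 2) *
        ∏ p ∈ Finset.univ.filter (fun p : Fin n × Fin n => p.1 < p.2),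
          (MvPolynomial.X p.1 + MvPolynomial.X p.2) *
            (MvPolynomial.X p.1 - MvPolynomial.X p.2)) ∧
    (¬ SignedOdd n w → POdd n w = 0) := by
  exact ⟨SignedOdd.POdd_eq, fun h => by_contra fun h' => h (signedOdd_of_POdd_ne_zero h')⟩
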